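/- arXiv:math/0202001 — 2 statements merged into one kernel-verified Lean document; each statement's English description precedes it below -/
import Mathlib

section
/- The semigroup generated by a and b inside IMG(z²−1) is free: distinct non-empty positive words in the letters a, b define distinct transformations of {0,1}^ω, i.e. the monoid homomorphism from the free monoid on two generators to the transformations of {0,1}^ω sending the generators to a and b is injective. In particular the group IMG(z²−1) has exponential growth. -/
/-- Prepend a letter to an infinite binary sequence: `cns x w = xw`. -/
def cns (x : Bool) (w : ℕ → Bool) : ℕ → Bool :=
  fun n => match n with
  | 0 => x
  | k + 1 => w k

/-- The growth function of a group of permutations with respect to a generating set `S`: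
the number of elements expressible as a product of at most `n` elements of `S`. -/
noncomputable def growthFn (S : Set (Equiv.Perm (ℕ → Bool))) (n : ℕ) : ℕ :=
  Nat.card {g : Equiv.Perm (ℕ → Bool) |
    ∃ l : List (Equiv.Perm (ℕ → Bool)), l.length ≤ n ∧ (∀ x ∈ l, x ∈ S) ∧ l.prod = g}

/-- The permutation defined by a word in the letters `g 0`, `g 1`; the head of the list is
applied first. -/
def wordPerm {X : Type*} (g : Fin 2 → Equiv.Perm X) : List (Fin 2) → Equiv.Perm X
  | [] => 1
  | x :: l => wordPerm g l * g x

/-- The section of a word at a first letter, with respect to the recursions of `IMG(z²−1)`. -/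
def wordSection : Bool → List (Fin 2) → List (Fin 2)
  | _, [] => []
  | false, 0 :: l => 1 :: wordSection true l
  | true, 0 :: l => wordSection false l
  | false, 1 :: l => 0 :: wordSection false l
  | true, 1 :: l => wordSection true l

/-- The image of a first letter under a word. -/
def wordLetter (x : Bool) (l : List (Fin 2)) : Bool :=
  l.foldl (fun y i => if i = 0 then !y else y) x

theorem cns_inj {x y : Bool} {w z : ℕ → Bool} : cns x w = cns y z ↔ x = y ∧ w = z := by
  constructor
  · intro h
    exact ⟨congrFun h 0, funext fun n => congrFun h (n + 1)⟩
  · rintro ⟨rfl, rfl⟩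
    rfl

section Words

variable {X : Type*} (g : Fin 2 → Equiv.Perm X)

theorem wordPerm_append (l m : List (Fin 2)) :
    wordPerm g (l ++ m) = wordPerm g m * wordPerm g l := by
  induction l with
  | nil => simp [wordPerm]
  | cons x l ih => simp [wordPerm, ih, mul_assoc]

theorem lift_eq_wordPerm_reverse (w : FreeMonoid (Fin 2)) :
    FreeMonoid.lift g w = wordPerm g w.toList.reverse := by
  induction w using FreeMonoid.inductionOn' with
  | one => simp [wordPerm]
  | of_mul x w ih => simp [wordPerm, wordPerm_append, ih]

end Words

theorem length_wordSection (l : List (Fin 2)) :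
    (wordSection false l).length + (wordSection true l).length = l.length := by
  induction l with
  | nil => rfl
  | cons x l ih => fin_cases x <;> simp [wordSection] <;> omega

theorem wordSection_false_eq_nil {l : List (Fin 2)} : wordSection false l = [] ↔ l = [] := by
  rcases l with _ | ⟨x, l⟩
  · simp [wordSection]
  · fin_cases x <;> simp [wordSection]

theorem eq_replicate_of_wordSection_true_eq_nil {l : List (Fin 2)}
    (h : wordSection true l = []) :
    ∃ k, l = List.replicate k 1 ∨ l = List.replicate k 1 ++ [0] := by
  induction l with
  | nil => exact ⟨0, by simp⟩
  | cons x l ih =>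
    fin_cases x
    · have hl : l = [] := wordSection_false_eq_nil.1 h
      exact ⟨0, by simp [hl]⟩
    · obtain ⟨k, hk | hk⟩ := ih h
      · exact ⟨k + 1, by simp [hk, List.replicate_succ]⟩
      · exact ⟨k + 1, by simp [hk, List.replicate_succ]⟩

theorem wordSection_false_replicate_one (k : ℕ) :
    wordSection false (List.replicate k 1) = List.replicate k 0 := by
  induction k with
  | zero => rfl
  | succ k ih => simp [List.replicate_succ, wordSection, ih]

theorem wordLetter_replicate_one (x : Bool) (k : ℕ) :
    wordLetter x (List.replicate k 1) = x := by
  induction k with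
  | zero => rfl
  | succ k ih => simpa [wordLetter, List.replicate_succ] using ih

theorem wordLetter_replicate_one_append (x : Bool) (k : ℕ) :
    wordLetter x (List.replicate k 1 ++ [0]) = !x := by
  have h := wordLetter_replicate_one x k
  simp only [wordLetter] at h
  simp [wordLetter, List.foldl_append, h]

section Recursion

variable {g : Fin 2 → Equiv.Perm (ℕ → Bool)}
  (h00 : ∀ w, g 0 (cns false w) = cns true (g 1 w))
  (h01 : ∀ w, g 0 (cns true w) = cns false w)
  (h10 : ∀ w, g 1 (cns false w) = cns false (g 0 w))
  (h11 : ∀ w, g 1 (cns true w) = cns true w)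

include h00 h01 h10 h11

theorem wordPerm_cns (x : Bool) (l : List (Fin 2)) (w : ℕ → Bool) :
    wordPerm g l (cns x w) = cns (wordLetter x l) (wordPerm g (wordSection x l) w) := by
  induction l generalizing x w with
  | nil => cases x <;> rfl
  | cons i l ih =>
    fin_cases i <;> cases x <;>
      simp [wordPerm, wordSection, wordLetter, h00, h01, h10, h11, ih]

theorem wordLetter_eq_and_wordPerm_wordSection_eq {u v : List (Fin 2)}
    (h : wordPerm g u = wordPerm g v) (x : Bool) :
    wordLetter x u = wordLetter x v ∧
      wordPerm g (wordSection x u) = wordPerm g (wordSection x v) := by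
  have key (w) := cns_inj.1 <| by
    simpa only [wordPerm_cns h00 h01 h10 h11] using congrArg (fun p => p (cns x w)) h
  exact ⟨(key fun _ => x).1, Equiv.ext fun w => (key w).2⟩

theorem eq_nil_of_wordPerm_eq_one {l : List (Fin 2)} (h : wordPerm g l = 1) : l = [] := by
  have sec {l : List (Fin 2)} (h : wordPerm g l = 1) :=
    wordLetter_eq_and_wordPerm_wordSection_eq h00 h01 h10 h11 (u := l) (v := []) h
  induction hn : l.length using Nat.strong_induction_on generalizing l with
  | _ n ih =>
  subst hn
  -- The section at `0` is strictly shorter unless the section at `1` is empty.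
  have descend {m : List (Fin 2)} (hm : wordPerm g m = 1) (hlen : m.length ≤ l.length)
      (hne : wordSection true m ≠ []) : m = [] := by
    have h₁ := length_wordSection m
    have h₂ := List.length_pos_iff.2 hne
    exact wordSection_false_eq_nil.1 <| ih _ (by omega) (sec hm false).2 rfl
  by_cases ht : wordSection true l = []
  · obtain ⟨k, rfl | rfl⟩ := eq_replicate_of_wordSection_true_eq_nil ht
    · have h₀ : wordPerm g (List.replicate k 0) = 1 := by
        simpa [wordSection_false_replicate_one, wordSection, wordPerm] using (sec h false).2
      rcases k with _ | _ | k
      · rfl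
      · exact absurd (sec h₀ false).1 (by decide)
      · have := descend h₀ (by simp) (by simp [List.replicate_succ, wordSection])
        simp at this
    · have := (sec h false).1
      rw [wordLetter_replicate_one_append] at this
      simp [wordLetter] at this
  · exact descend h le_rfl ht

theorem wordPerm_zero_cons_ne_one_cons {u v : List (Fin 2)}
    (ih : ∀ u' v' : List (Fin 2), u'.length + v'.length < u.length + v.length + 2 →
      wordPerm g u' = wordPerm g v' → u' = v') :
    wordPerm g (0 :: u) ≠ wordPerm g (1 :: v) := by
  intro h
  have sec := wordLetter_eq_and_wordPerm_wordSection_eq h00 h01 h10 h11 h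
  have hu := length_wordSection (0 :: u)
  have hv := length_wordSection (1 :: v)
  simp only [List.length_cons] at hu hv
  by_cases hlen : (wordSection true (0 :: u)).length + (wordSection true (1 :: v)).length = 0
  · have hu₁ : u = [] :=
      wordSection_false_eq_nil.1 <| List.length_eq_zero_iff.1 (Nat.add_eq_zero_iff.1 hlen).1
    have hv₁ : wordSection true v = [] :=
      List.length_eq_zero_iff.1 (Nat.add_eq_zero_iff.1 hlen).2
    subst hu₁
    obtain ⟨k, rfl | rfl⟩ := eq_replicate_of_wordSection_true_eq_nil hv₁
    · have := (sec false).1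
      rw [← List.replicate_succ, wordLetter_replicate_one] at this
      simp [wordLetter] at this
    · rw [← List.cons_append, wordPerm_append] at h
      have := eq_nil_of_wordPerm_eq_one h00 h01 h10 h11
        (mul_eq_left.1 (h.symm.trans (by simp [wordPerm])))
      simp at this
  · have := ih _ _ (by omega) (sec false).2
    simp [wordSection] at this

theorem wordPerm_injective : Function.Injective (wordPerm g) := by
  intro u v h
  induction hn : u.length + v.length using Nat.strong_induction_on generalizing u v with
  | _ n ih =>
  subst hn
  rcases u with _ | ⟨x, u⟩
  · exact (eq_nil_of_wordPerm_eq_one h00 h01 h10 h11 h.symm).symm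
  rcases v with _ | ⟨y, v⟩
  · exact eq_nil_of_wordPerm_eq_one h00 h01 h10 h11 h
  by_cases hxy : x = y
  · subst hxy
    rw [ih _ (by simp; omega) (mul_right_cancel h) rfl]
  · exfalso
    fin_cases x <;> fin_cases y
    · exact hxy rfl
    · exact wordPerm_zero_cons_ne_one_cons h00 h01 h10 h11
        (fun u' v' hl h' => ih _ (by simp; omega) h' rfl) h
    · exact wordPerm_zero_cons_ne_one_cons h00 h01 h10 h11
        (fun u' v' hl h' => ih _ (by simp; omega) h' rfl) h.symm
    · exact hxy rfl

theorem lift_injective : Function.Injective (FreeMonoid.lift g) := by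
  intro u v h
  simp only [lift_eq_wordPerm_reverse] at h
  exact FreeMonoid.toList.injective
    (List.reverse_injective (wordPerm_injective h00 h01 h10 h11 h))

end Recursion

theorem finite_setOf_prod_length_le {G : Type*} [Monoid G] {S : Set G} (hS : S.Finite) (n : ℕ) :
    {x : G | ∃ l : List G, l.length ≤ n ∧ (∀ y ∈ l, y ∈ S) ∧ l.prod = x}.Finite := by
  have := hS.to_subtype
  refine ((List.finite_length_le S n).image fun l => (l.map Subtype.val).prod).subset ?_
  rintro x ⟨l, hl, hS, rfl⟩
  lift l to List S using hS
  exact ⟨l, by simpa using hl, rfl⟩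

theorem two_pow_le_growthFn {S : Set (Equiv.Perm (ℕ → Bool))} (hS : S.Finite)
    {g : Fin 2 → Equiv.Perm (ℕ → Bool)} (hg : ∀ i, g i ∈ S)
    (hinj : Function.Injective (FreeMonoid.lift g)) (n : ℕ) : 2 ^ n ≤ growthFn S n := by
  have := (finite_setOf_prod_length_le hS n).to_subtype
  let f : (Fin n → Fin 2) → {x : Equiv.Perm (ℕ → Bool) |
      ∃ l : List (Equiv.Perm (ℕ → Bool)), l.length ≤ n ∧ (∀ y ∈ l, y ∈ S) ∧ l.prod = x} :=
    fun t => ⟨FreeMonoid.lift g (FreeMonoid.ofList (List.ofFn t)),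
      (List.ofFn t).map g, by simp, by simp [hg], by simp [FreeMonoid.lift_apply]⟩
  have hf : Function.Injective f := fun s t h =>
    List.ofFn_injective (FreeMonoid.ofList.injective (hinj (congrArg Subtype.val h)))
  simpa [growthFn] using Nat.card_le_card_of_injective f hf

/-- The semigroup generated by the generators `a, b` of `IMG(z²−1)` is free: the monoid
homomorphism from the free monoid on two generators to the transformations of `{0,1}^ω`
sending the generators to `a` and `b` is injective. In particular `IMG(z²−1)` has
exponential growth. -/
theorem img_z2_minus_1_free_semigroup
    (a b : Equiv.Perm (ℕ → Bool))
    (ha0 : ∀ w, a (cns false w) = cns true (b w))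
    (ha1 : ∀ w, a (cns true w) = cns false w)
    (hb0 : ∀ w, b (cns false w) = cns false (a w))
    (hb1 : ∀ w, b (cns true w) = cns true w) :
    (∀ φ : FreeMonoid (Fin 2) →* Function.End (ℕ → Bool),
      φ (FreeMonoid.of 0) = ⇑a → φ (FreeMonoid.of 1) = ⇑b → Function.Injective φ) ∧
    (∃ c : ℝ, 1 < c ∧ ∀ n : ℕ, c ^ n ≤ (growthFn {a, b, a⁻¹, b⁻¹} n : ℝ)) := by
  have hinj : Function.Injective (FreeMonoid.lift ![a, b]) := lift_injective ha0 ha1 hb0 hb1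
  refine ⟨fun φ h0 h1 => ?_, 2, one_lt_two, fun n => ?_⟩
  · have hφ : φ = MulAction.toEndHom.comp (FreeMonoid.lift ![a, b]) := by
      refine FreeMonoid.hom_eq fun i => ?_
      fin_cases i
      · exact h0
      · exact h1
    intro u v h
    rw [hφ] at h
    exact hinj (Equiv.ext (congrFun h))
  · exact_mod_cast two_pow_le_growthFn (S := {a, b, a⁻¹, b⁻¹}) (g := ![a, b]) (by simp)
      (Fin.forall_fin_two.2 ⟨by simp, by simp⟩) hinj n
end

section
/- The group G = IMG(z²−1) is just non-solvable: G is not solvable, but for every non-trivial normal subgroup N of G the quotient G/N is solvable. Moreover G contains no free non-abelian subgroup: no subgroup of G is isomorphic to the free group of rank 2. -/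
/-- The iterated commutator subgroups of a subgroup: the images of its derived series. -/
def iteratedCommutator {Γ : Type*} [Group Γ] (H : Subgroup Γ) : ℕ → Subgroup Γ
  | 0 => H
  | n + 1 => ⁅iteratedCommutator H n, iteratedCommutator H n⁆

open scoped commutatorElement

section IteratedCommutator

variable {Γ : Type*} [Group Γ] {H : Subgroup Γ}

theorem map_subtype_derivedSeries (H : Subgroup Γ) (n : ℕ) :
    (derivedSeries H n).map H.subtype = iteratedCommutator H n := by
  induction n with
  | zero => simp [iteratedCommutator, ← MonoidHom.range_eq_map]
  | succ n ih => rw [derivedSeries_succ, Subgroup.map_commutator, ih]; rfl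

theorem conj_mem_iteratedCommutator {g : Γ} (hg : g ∈ H) (n : ℕ) {x : Γ}
    (hx : x ∈ iteratedCommutator H n) : g * x * g⁻¹ ∈ iteratedCommutator H n := by
  have key : (iteratedCommutator H n).map (MulAut.conj g).toMonoidHom
      ≤ iteratedCommutator H n := by
    clear hx
    induction n with
    | zero =>
      rintro _ ⟨y, hy, rfl⟩
      exact H.mul_mem (H.mul_mem hg hy) (H.inv_mem hg)
    | succ n ih =>
      simp only [iteratedCommutator]
      rw [Subgroup.map_commutator]
      exact Subgroup.commutator_mono ih ih
  exact key ⟨x, hx, rfl⟩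

theorem Subgroup.commutator_self_le (K : Subgroup Γ) : ⁅K, K⁆ ≤ K :=
  Subgroup.commutator_le.2 fun _ hx _ hy =>
    K.mul_mem (K.mul_mem (K.mul_mem hx hy) (K.inv_mem hx)) (K.inv_mem hy)

theorem iteratedCommutator_antitone (H : Subgroup Γ) : Antitone (iteratedCommutator H) :=
  antitone_nat_of_succ_le fun n => (iteratedCommutator H n).commutator_self_le

/-- A subgroup invariant under conjugation by `closure S` that contains the commutators of
elements of `S` contains the commutator subgroup of `closure S`. -/
theorem commutator_closure_le {S : Set Γ} {C : Subgroup Γ}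
    (hC : ∀ g ∈ Subgroup.closure S, ∀ x ∈ C, g * x * g⁻¹ ∈ C)
    (h : ∀ s ∈ S, ∀ t ∈ S, ⁅s, t⁆ ∈ C) :
    ⁅Subgroup.closure S, Subgroup.closure S⁆ ≤ C := by
  have extend : ∀ y : Γ, (∀ t ∈ S, ⁅y, t⁆ ∈ C) → ∀ g ∈ Subgroup.closure S, ⁅y, g⁆ ∈ C := by
    intro y hy g hg
    induction hg using Subgroup.closure_induction with
    | mem t ht => exact hy t ht
    | one => simp
    | mul g k hg hk ihg ihk =>
      have e : ⁅y, g * k⁆ = ⁅y, g⁆ * (g * ⁅y, k⁆ * g⁻¹) := by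
        simp only [commutatorElement_def]; group
      rw [e]
      exact C.mul_mem ihg (hC g hg _ ihk)
    | inv g hg ihg =>
      have e : ⁅y, g⁻¹⁆ = g⁻¹ * ⁅y, g⁆⁻¹ * g⁻¹⁻¹ := by
        simp only [commutatorElement_def]; group
      rw [e]
      exact hC _ (Subgroup.inv_mem _ hg) _ (C.inv_mem ihg)
  have swap : ∀ x y : Γ, ⁅x, y⁆ ∈ C → ⁅y, x⁆ ∈ C := fun x y hxy => by
    rw [← commutatorElement_inv]; exact C.inv_mem hxy
  exact Subgroup.commutator_le.2 fun g hg k hk =>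
    extend g (fun t ht => swap _ _ (extend t (h t ht) g hg)) k hk

end IteratedCommutator

theorem cns_zero_tail (w : ℕ → Bool) : cns (w 0) (fun n => w (n + 1)) = w := by
  funext n; cases n <;> rfl

@[simp] theorem cns_inj_s17 {c d : Bool} {v w : ℕ → Bool} : cns c v = cns d w ↔ c = d ∧ v = w := by
  constructor
  · intro h
    exact ⟨congrFun h 0, funext fun n => congrFun h (n + 1)⟩
  · rintro ⟨rfl, rfl⟩; rfl

theorem forall_cns {P : (ℕ → Bool) → Prop} : (∀ w, P w) ↔ ∀ c w, P (cns c w) :=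
  ⟨fun h _ _ => h _, fun h w => cns_zero_tail w ▸ h _ _⟩

/-- The permutation acting as `x` below the letter `0` and as `y` below the letter `1`. -/
def pairPerm (x y : Equiv.Perm (ℕ → Bool)) : Equiv.Perm (ℕ → Bool) where
  toFun w := cns (w 0) ((bif w 0 then y else x) fun n => w (n + 1))
  invFun w := cns (w 0) ((bif w 0 then y⁻¹ else x⁻¹) fun n => w (n + 1))
  left_inv := forall_cns.2 fun c w => by cases c <;> simp [cns]
  right_inv := forall_cns.2 fun c w => by cases c <;> simp [cns]

@[simp] theorem pairPerm_cns_false (x y : Equiv.Perm (ℕ → Bool)) (w : ℕ → Bool) :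
    pairPerm x y (cns false w) = cns false (x w) := rfl

@[simp] theorem pairPerm_cns_true (x y : Equiv.Perm (ℕ → Bool)) (w : ℕ → Bool) :
    pairPerm x y (cns true w) = cns true (y w) := rfl

theorem perm_ext_cns {g h : Equiv.Perm (ℕ → Bool)} (h0 : ∀ w, g (cns false w) = h (cns false w))
    (h1 : ∀ w, g (cns true w) = h (cns true w)) : g = h :=
  Equiv.ext (forall_cns.2 fun c w => by cases c; exacts [h0 w, h1 w])

/-- `pairPerm` as a group homomorphism. -/
def pairHom : Equiv.Perm (ℕ → Bool) × Equiv.Perm (ℕ → Bool) →* Equiv.Perm (ℕ → Bool) where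
  toFun p := pairPerm p.1 p.2
  map_one' := perm_ext_cns (fun _ => rfl) (fun _ => rfl)
  map_mul' _ _ := perm_ext_cns (fun _ => rfl) (fun _ => rfl)

theorem pairHom_apply (x y : Equiv.Perm (ℕ → Bool)) : pairHom (x, y) = pairPerm x y := rfl

theorem pairPerm_mul (x y x' y' : Equiv.Perm (ℕ → Bool)) :
    pairPerm x y * pairPerm x' y' = pairPerm (x * x') (y * y') :=
  (map_mul pairHom (x, y) (x', y')).symm

theorem pairPerm_inv (x y : Equiv.Perm (ℕ → Bool)) :
    (pairPerm x y)⁻¹ = pairPerm x⁻¹ y⁻¹ :=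
  (map_inv pairHom (x, y)).symm

theorem pairPerm_inj {x y x' y' : Equiv.Perm (ℕ → Bool)} :
    pairPerm x y = pairPerm x' y' ↔ x = x' ∧ y = y' := by
  constructor
  · intro h
    refine ⟨Equiv.ext fun w => ?_, Equiv.ext fun w => ?_⟩
    · simpa using Equiv.congr_fun h (cns false w)
    · simpa using Equiv.congr_fun h (cns true w)
  · rintro ⟨rfl, rfl⟩; rfl

/-- The defining recursions of the generators of `IMG(z²−1)`. -/
structure IsBasilica (a b : Equiv.Perm (ℕ → Bool)) : Prop where
  a_false : ∀ w, a (cns false w) = cns true (b w)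
  a_true : ∀ w, a (cns true w) = cns false w
  b_false : ∀ w, b (cns false w) = cns false (a w)
  b_true : ∀ w, b (cns true w) = cns true w

/-- `g` changes the first letter by `c` and acts below it by elements of `G`. -/
def HasSectionsIn (G : Subgroup (Equiv.Perm (ℕ → Bool))) (c : Bool)
    (g : Equiv.Perm (ℕ → Bool)) : Prop :=
  ∃ x ∈ G, ∃ y ∈ G, (∀ w, g (cns false w) = cns c (x w)) ∧ ∀ w, g (cns true w) = cns (!c) (y w)

theorem HasSectionsIn.mul {G : Subgroup (Equiv.Perm (ℕ → Bool))} {c d : Bool}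
    {g h : Equiv.Perm (ℕ → Bool)} (hg : HasSectionsIn G c g) (hh : HasSectionsIn G d h) :
    HasSectionsIn G (c ^^ d) (g * h) := by
  obtain ⟨x, hx, y, hy, h0, h1⟩ := hg
  obtain ⟨x', hx', y', hy', h0', h1'⟩ := hh
  cases d
  · exact ⟨x * x', G.mul_mem hx hx', y * y', G.mul_mem hy hy',
      fun w => by simp [h0, h0'], fun w => by simp [h1, h1']⟩
  · exact ⟨y * x', G.mul_mem hy hx', x * y', G.mul_mem hx hy',
      fun w => by simp [h1, h0'], fun w => by simp [h0, h1']⟩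

theorem HasSectionsIn.inv {G : Subgroup (Equiv.Perm (ℕ → Bool))} {c : Bool}
    {g : Equiv.Perm (ℕ → Bool)} (hg : HasSectionsIn G c g) : HasSectionsIn G c g⁻¹ := by
  obtain ⟨x, hx, y, hy, h0, h1⟩ := hg
  cases c
  · exact ⟨x⁻¹, G.inv_mem hx, y⁻¹, G.inv_mem hy,
      fun w => by simp [Equiv.symm_apply_eq, h0],
      fun w => by simp [Equiv.symm_apply_eq, h1]⟩
  · exact ⟨y⁻¹, G.inv_mem hy, x⁻¹, G.inv_mem hx,
      fun w => by simp [Equiv.symm_apply_eq, h1],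
      fun w => by simp [Equiv.symm_apply_eq, h0]⟩

theorem HasSectionsIn.exists_eq_pairPerm {G : Subgroup (Equiv.Perm (ℕ → Bool))}
    {g : Equiv.Perm (ℕ → Bool)} (hg : HasSectionsIn G false g) :
    ∃ x ∈ G, ∃ y ∈ G, pairPerm x y = g := by
  obtain ⟨x, hx, y, hy, h0, h1⟩ := hg
  exact ⟨x, hx, y, hy, perm_ext_cns (fun w => (h0 w).symm) fun w => (h1 w).symm⟩

namespace IsBasilica

variable {a b : Equiv.Perm (ℕ → Bool)}

theorem b_eq (h : IsBasilica a b) : b = pairPerm a 1 :=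
  perm_ext_cns h.b_false h.b_true

theorem a_mul_a (h : IsBasilica a b) : a * a = pairPerm b b :=
  perm_ext_cns (fun w => by simp [h.a_false, h.a_true]) fun w => by simp [h.a_false, h.a_true]

theorem a_inv_false (h : IsBasilica a b) (w : ℕ → Bool) : a.symm (cns false w) = cns true w := by
  simp [Equiv.symm_apply_eq, h.a_true]

theorem a_inv_true (h : IsBasilica a b) (w : ℕ → Bool) :
    a.symm (cns true w) = cns false (b.symm w) := by
  simp [Equiv.symm_apply_eq, h.a_false]

theorem b_inv_false (h : IsBasilica a b) (w : ℕ → Bool) :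
    b.symm (cns false w) = cns false (a.symm w) := by
  simp [Equiv.symm_apply_eq, h.b_false]

theorem b_inv_true (h : IsBasilica a b) (w : ℕ → Bool) : b.symm (cns true w) = cns true w := by
  simp [Equiv.symm_apply_eq, h.b_true]

theorem conj_a_pairPerm (h : IsBasilica a b) (x y : Equiv.Perm (ℕ → Bool)) :
    a * pairPerm x y * a⁻¹ = pairPerm y (b * x * b⁻¹) :=
  perm_ext_cns (fun w => by simp [h.a_inv_false, h.a_true])
    fun w => by simp [h.a_inv_true, h.a_false]

theorem conj_a_inv_pairPerm (h : IsBasilica a b) (x y : Equiv.Perm (ℕ → Bool)) :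
    a⁻¹ * pairPerm x y * a = pairPerm (b⁻¹ * y * b) x :=
  perm_ext_cns (fun w => by simp [h.a_inv_true, h.a_false])
    fun w => by simp [h.a_inv_false, h.a_true]

theorem a_ne_one (h : IsBasilica a b) : a ≠ 1 := fun e => by
  have := h.a_true fun _ => false
  simp [e] at this

theorem b_ne_one (h : IsBasilica a b) : b ≠ 1 := fun e => h.a_ne_one <| Equiv.ext fun w => by
  have := h.b_false w
  simpa [e] using this.symm

theorem a_mem (a b : Equiv.Perm (ℕ → Bool)) : a ∈ Subgroup.closure {a, b} :=
  Subgroup.subset_closure (by simp)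

theorem b_mem (a b : Equiv.Perm (ℕ → Bool)) : b ∈ Subgroup.closure {a, b} :=
  Subgroup.subset_closure (by simp)

theorem exists_hasSectionsIn (h : IsBasilica a b) {g : Equiv.Perm (ℕ → Bool)}
    (hg : g ∈ Subgroup.closure {a, b}) :
    ∃ c, HasSectionsIn (Subgroup.closure {a, b}) c g := by
  induction hg using Subgroup.closure_induction with
  | mem g hg =>
    obtain rfl | rfl := hg
    · exact ⟨true, b, b_mem _ _, 1, Subgroup.one_mem _, h.a_false, h.a_true⟩
    · exact ⟨false, a, a_mem _ _, 1, Subgroup.one_mem _, h.b_false, h.b_true⟩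
  | one => exact ⟨false, 1, Subgroup.one_mem _, 1, Subgroup.one_mem _, fun _ => rfl, fun _ => rfl⟩
  | mul g k _ _ ihg ihk =>
    obtain ⟨c, hc⟩ := ihg
    obtain ⟨d, hd⟩ := ihk
    exact ⟨_, hc.mul hd⟩
  | inv g _ ihg => exact ihg.imp fun _ hc => hc.inv

theorem mem_of_pairPerm_mem (h : IsBasilica a b) {x y : Equiv.Perm (ℕ → Bool)}
    (hxy : pairPerm x y ∈ Subgroup.closure {a, b}) : x ∈ Subgroup.closure {a, b} := by
  obtain ⟨c, x', hx', y', hy', h0, -⟩ := h.exists_hasSectionsIn hxy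
  have : x = x' := Equiv.ext fun w => (cns_inj_s17.1 (h0 w)).2
  exact this ▸ hx'

/-- Every element of `G` is the first section of an element of `G` of the form `(s, t)`. -/
theorem exists_pairPerm_mem (h : IsBasilica a b) {s : Equiv.Perm (ℕ → Bool)}
    (hs : s ∈ Subgroup.closure {a, b}) : ∃ t, pairPerm s t ∈ Subgroup.closure {a, b} := by
  have key : Subgroup.closure {a, b} ≤
      ((Subgroup.closure {a, b}).comap pairHom).map (MonoidHom.fst _ _) := by
    rw [Subgroup.closure_le]
    rintro s (rfl | rfl)
    · exact ⟨(s, 1), h.b_eq ▸ b_mem s b, rfl⟩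
    · refine ⟨(s, s), ?_, rfl⟩
      change pairPerm s s ∈ Subgroup.closure {a, s}
      rw [← h.a_mul_a]
      exact Subgroup.mul_mem _ (a_mem _ _) (a_mem _ _)
  obtain ⟨⟨s', t⟩, ht, rfl⟩ := key hs
  exact ⟨t, ht⟩

theorem iteratedCommutator_succ_le (h : IsBasilica a b) (n : ℕ) :
    iteratedCommutator (Subgroup.closure {a, b}) (n + 1) ≤
      ((iteratedCommutator (Subgroup.closure {a, b}) n).prod
        (iteratedCommutator (Subgroup.closure {a, b}) n)).map pairHom := by
  induction n with
  | zero =>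
    refine Subgroup.commutator_le.2 fun g hg k hk => ?_
    obtain ⟨c, hc⟩ := h.exists_hasSectionsIn hg
    obtain ⟨d, hd⟩ := h.exists_hasSectionsIn hk
    have := ((hc.mul hd).mul hc.inv).mul hd.inv
    have e : (((c ^^ d) ^^ c) ^^ d) = false := by cases c <;> cases d <;> rfl
    rw [e] at this
    obtain ⟨x, hx, y, hy, e⟩ := this.exists_eq_pairPerm
    exact ⟨(x, y), ⟨hx, hy⟩, e⟩
  | succ n ih =>
    refine (Subgroup.commutator_mono ih ih).trans ?_
    rw [← Subgroup.map_commutator, Subgroup.commutator_prod_prod]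
    rfl

/-- `G'` contains `G' × 1`. -/
theorem pairPerm_one_mem (h : IsBasilica a b) {x : Equiv.Perm (ℕ → Bool)}
    (hx : x ∈ iteratedCommutator (Subgroup.closure {a, b}) 1) :
    pairPerm x 1 ∈ iteratedCommutator (Subgroup.closure {a, b}) 1 := by
  have key : iteratedCommutator (Subgroup.closure {a, b}) 1 ≤
      (iteratedCommutator (Subgroup.closure {a, b}) 1).comap
        (pairHom.comp (MonoidHom.inl _ _)) := by
    refine commutator_closure_le (fun g hg y hy => ?_) ?_
    · obtain ⟨t, ht⟩ := h.exists_pairPerm_mem hg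
      have := conj_mem_iteratedCommutator ht 1 (show pairPerm y 1 ∈ _ from hy)
      rw [pairPerm_inv, pairPerm_mul, pairPerm_mul] at this
      simpa [pairHom_apply] using this
    · have hab : ⁅b, a * a⁆ = pairPerm ⁅a, b⁆ 1 := by
        rw [commutatorElement_def, h.a_mul_a]
        nth_rw 1 [h.b_eq]
        nth_rw 3 [h.b_eq]
        simp only [pairPerm_inv, pairPerm_mul, commutatorElement_def]
        simp
      have m : pairPerm ⁅a, b⁆ 1 ∈ iteratedCommutator (Subgroup.closure {a, b}) 1 :=
        hab ▸ Subgroup.commutator_mem_commutator (b_mem _ _)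
          (Subgroup.mul_mem _ (a_mem _ _) (a_mem _ _))
      rintro s (rfl | rfl) t (rfl | rfl)
      · simp
      · exact m
      · rw [← commutatorElement_inv]
        exact Subgroup.inv_mem _ m
      · simp
  exact key hx

theorem exists_not_commute (h : IsBasilica a b) :
    ∃ x ∈ iteratedCommutator (Subgroup.closure {a, b}) 1,
      ∃ y ∈ iteratedCommutator (Subgroup.closure {a, b}) 1, x * y ≠ y * x := by
  have e : ⁅a⁻¹, b⁆ = pairPerm a⁻¹ a := by
    have e1 : ⁅a⁻¹, b⁆ = (a⁻¹ * b * a) * b⁻¹ := by simp [commutatorElement_def]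
    rw [e1]
    nth_rw 2 [h.b_eq]
    nth_rw 1 [h.b_eq]
    rw [h.conj_a_inv_pairPerm, pairPerm_inv, pairPerm_mul]
    simp
  have m : pairPerm a⁻¹ a ∈ iteratedCommutator (Subgroup.closure {a, b}) 1 :=
    e ▸ Subgroup.commutator_mem_commutator (Subgroup.inv_mem _ (a_mem _ _)) (b_mem _ _)
  refine ⟨_, m, _, conj_mem_iteratedCommutator
    (Subgroup.mul_mem _ (a_mem _ _) (a_mem _ _)) 1 m, fun hc => ?_⟩
  rw [h.a_mul_a, pairPerm_inv] at hc
  simp only [pairPerm_mul, pairPerm_inj] at hc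
  have hw : ∀ w, b (a w) = b (a.symm w) := fun w => by
    have := Equiv.congr_fun hc.2 (cns true w)
    simpa [h.a_true, h.a_false, h.b_true, h.b_false, h.b_inv_true, h.b_inv_false,
      h.a_inv_true, h.a_inv_false] using this
  refine h.b_ne_one (Equiv.ext fun w => ?_)
  have := hw (cns false w)
  rw [b.injective.eq_iff, h.a_false, h.a_inv_false] at this
  simpa using this

/-- The first sections of the elements of `N` that fix the first letter. -/
def firstSections (N : Subgroup (Equiv.Perm (ℕ → Bool))) : Subgroup (Equiv.Perm (ℕ → Bool)) :=
  (N.comap pairHom).map (MonoidHom.fst _ _)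

theorem mem_firstSections {N : Subgroup (Equiv.Perm (ℕ → Bool))} {x : Equiv.Perm (ℕ → Bool)} :
    x ∈ firstSections N ↔ ∃ y, pairPerm x y ∈ N := by
  constructor
  · rintro ⟨⟨x, y⟩, hxy, rfl⟩
    exact ⟨y, hxy⟩
  · rintro ⟨y, hxy⟩
    exact ⟨(x, y), hxy, rfl⟩

variable {N : Subgroup (Equiv.Perm (ℕ → Bool))}

theorem firstSections_le (h : IsBasilica a b) (hN : N ≤ Subgroup.closure {a, b}) :
    firstSections N ≤ Subgroup.closure {a, b} := fun x hx => by
  obtain ⟨y, hy⟩ := mem_firstSections.1 hx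
  exact h.mem_of_pairPerm_mem (hN hy)

theorem conj_mem_firstSections (h : IsBasilica a b)
    (hN : ∀ g ∈ Subgroup.closure {a, b}, ∀ x ∈ N, g * x * g⁻¹ ∈ N) :
    ∀ g ∈ Subgroup.closure {a, b}, ∀ x ∈ firstSections N, g * x * g⁻¹ ∈ firstSections N := by
  intro g hg x hx
  obtain ⟨t, ht⟩ := h.exists_pairPerm_mem hg
  obtain ⟨y, hy⟩ := mem_firstSections.1 hx
  refine mem_firstSections.2 ⟨t * y * t⁻¹, ?_⟩
  simpa only [pairPerm_inv, pairPerm_mul] using hN _ ht _ hy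

/-- If `N` contains an element changing the first letter, its first sections contain `G'`. -/
theorem iteratedCommutator_one_le_firstSections (h : IsBasilica a b)
    (hN : ∀ g ∈ Subgroup.closure {a, b}, ∀ x ∈ N, g * x * g⁻¹ ∈ N)
    {g : Equiv.Perm (ℕ → Bool)} (hg : g ∈ N)
    (hs : HasSectionsIn (Subgroup.closure {a, b}) true g) :
    iteratedCommutator (Subgroup.closure {a, b}) 1 ≤ firstSections N := by
  intro x hx
  obtain ⟨u, -, v, -, h0, h1⟩ := hs
  have e : pairPerm x 1 * g * (pairPerm x 1)⁻¹ * g⁻¹ = pairPerm x (u * x⁻¹ * u⁻¹) := by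
    rw [mul_inv_eq_iff_eq_mul, mul_inv_eq_iff_eq_mul]
    refine perm_ext_cns (fun w => ?_) fun w => ?_ <;> simp [h0, h1]
  refine mem_firstSections.2 ⟨_, e ▸ N.mul_mem (hN _ ?_ _ hg) (N.inv_mem hg)⟩
  exact iteratedCommutator_antitone _ zero_le_one (h.pairPerm_one_mem hx)

/-- Induction over the level at which a non-trivial normal subgroup acts non-trivially. -/
theorem normal_induction (h : IsBasilica a b) {P : Subgroup (Equiv.Perm (ℕ → Bool)) → Prop}
    (base : ∀ N : Subgroup (Equiv.Perm (ℕ → Bool)), N ≤ Subgroup.closure {a, b} →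
      (∀ g ∈ Subgroup.closure {a, b}, ∀ x ∈ N, g * x * g⁻¹ ∈ N) →
      iteratedCommutator (Subgroup.closure {a, b}) 1 ≤ firstSections N → P N)
    (step : ∀ N : Subgroup (Equiv.Perm (ℕ → Bool)), N ≤ Subgroup.closure {a, b} →
      (∀ g ∈ Subgroup.closure {a, b}, ∀ x ∈ N, g * x * g⁻¹ ∈ N) → P (firstSections N) → P N)
    (hle : N ≤ Subgroup.closure {a, b})
    (hN : ∀ g ∈ Subgroup.closure {a, b}, ∀ x ∈ N, g * x * g⁻¹ ∈ N) (hbot : N ≠ ⊥) : P N := by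
  have key : ∀ (n : ℕ) (N : Subgroup (Equiv.Perm (ℕ → Bool))), N ≤ Subgroup.closure {a, b} →
      (∀ g ∈ Subgroup.closure {a, b}, ∀ x ∈ N, g * x * g⁻¹ ∈ N) →
      (∃ g ∈ N, ∃ w, g w n ≠ w n) → P N := by
    intro n
    induction n with
    | zero =>
      rintro N hle hN ⟨g, hg, w, hw⟩
      obtain ⟨c, hc⟩ := h.exists_hasSectionsIn (hle hg)
      cases c with
      | true => exact base N hle hN (h.iteratedCommutator_one_le_firstSections hN hg hc)
      | false =>
        obtain ⟨x, -, y, -, rfl⟩ := hc.exists_eq_pairPerm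
        exact absurd rfl hw
    | succ n ih =>
      rintro N hle hN ⟨g, hg, w, hw⟩
      obtain ⟨c, hc⟩ := h.exists_hasSectionsIn (hle hg)
      cases c with
      | true => exact base N hle hN (h.iteratedCommutator_one_le_firstSections hN hg hc)
      | false =>
        obtain ⟨x, -, y, -, rfl⟩ := hc.exists_eq_pairPerm
        refine step N hle hN
          (ih _ (h.firstSections_le hle) (h.conj_mem_firstSections hN) ?_)
        have hy := hN a (a_mem a b) _ hg
        rw [h.conj_a_pairPerm] at hy
        rw [← cns_zero_tail w] at hw
        cases hw0 : w 0 <;> rw [hw0] at hw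
        · exact ⟨x, mem_firstSections.2 ⟨_, hg⟩, _, hw⟩
        · exact ⟨y, mem_firstSections.2 ⟨_, hy⟩, _, hw⟩
  obtain ⟨g, hg, hg1⟩ := N.bot_or_exists_ne_one.resolve_left hbot
  obtain ⟨w, hw⟩ := not_forall.1 fun hh => hg1 (Equiv.ext hh)
  obtain ⟨n, hn⟩ := Function.ne_iff.1 hw
  exact key n N hle hN ⟨g, hg, w, hn⟩

theorem commutator_ne_bot (h : IsBasilica a b) (hle : N ≤ Subgroup.closure {a, b})
    (hN : ∀ g ∈ Subgroup.closure {a, b}, ∀ x ∈ N, g * x * g⁻¹ ∈ N) (hbot : N ≠ ⊥) :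
    ⁅N, N⁆ ≠ ⊥ := by
  have lift : ∀ N : Subgroup (Equiv.Perm (ℕ → Bool)),
      (∃ x ∈ firstSections N, ∃ y ∈ firstSections N, x * y ≠ y * x) →
      ∃ x ∈ N, ∃ y ∈ N, x * y ≠ y * x := by
    rintro N ⟨x, hx, y, hy, hxy⟩
    obtain ⟨x', hx'⟩ := mem_firstSections.1 hx
    obtain ⟨y', hy'⟩ := mem_firstSections.1 hy
    refine ⟨_, hx', _, hy', fun e => hxy ?_⟩
    rw [pairPerm_mul, pairPerm_mul, pairPerm_inj] at e
    exact e.1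
  obtain ⟨x, hx, y, hy, hxy⟩ : ∃ x ∈ N, ∃ y ∈ N, x * y ≠ y * x := by
    refine h.normal_induction (P := fun N => ∃ x ∈ N, ∃ y ∈ N, x * y ≠ y * x)
      (fun N _ _ h1 => lift N ?_) (fun N _ _ => lift N) hle hN hbot
    obtain ⟨x, hx, y, hy, hxy⟩ := h.exists_not_commute
    exact ⟨x, h1 hx, y, h1 hy, hxy⟩
  intro e
  have := Subgroup.commutator_mem_commutator hx hy
  rw [e, Subgroup.mem_bot, commutatorElement_eq_one_iff_mul_comm] at this
  exact hxy this

theorem iteratedCommutator_ne_bot (h : IsBasilica a b) (n : ℕ) :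
    iteratedCommutator (Subgroup.closure {a, b}) n ≠ ⊥ := by
  induction n with
  | zero => exact fun e => h.a_ne_one (Subgroup.mem_bot.1 (e ▸ a_mem a b))
  | succ n ih =>
    exact h.commutator_ne_bot (iteratedCommutator_antitone _ n.zero_le)
      (fun g hg x hx => conj_mem_iteratedCommutator hg n hx) ih

theorem iteratedCommutator_le_of_le_firstSections (h : IsBasilica a b)
    (hN : ∀ g ∈ Subgroup.closure {a, b}, ∀ x ∈ N, g * x * g⁻¹ ∈ N) {n : ℕ}
    (hn : iteratedCommutator (Subgroup.closure {a, b}) (n + 1) ≤ firstSections N) :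
    iteratedCommutator (Subgroup.closure {a, b}) (n + 3) ≤ N := by
  have h1 : ∀ k, iteratedCommutator (Subgroup.closure {a, b}) (k + 1) ≤
      iteratedCommutator (Subgroup.closure {a, b}) 1 :=
    fun k => iteratedCommutator_antitone _ (by omega)
  have left : iteratedCommutator (Subgroup.closure {a, b}) (n + 2) ≤
      N.comap (pairHom.comp (MonoidHom.inl _ _)) := by
    refine Subgroup.commutator_le.2 fun x hx y hy => ?_
    obtain ⟨z, hz⟩ := mem_firstSections.1 (hn hx)
    have hy' := iteratedCommutator_antitone _ zero_le_one (h.pairPerm_one_mem (h1 n hy))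
    have := N.mul_mem hz (hN _ hy' _ (N.inv_mem hz))
    simp only [pairPerm_inv, pairPerm_mul] at this
    simpa [commutatorElement_def, pairHom_apply, mul_assoc] using this
  refine (h.iteratedCommutator_succ_le (n + 2)).trans ?_
  rintro _ ⟨⟨x, y⟩, ⟨hx, hy⟩, rfl⟩
  have hx' : pairPerm x 1 ∈ N := left hx
  have hy' : pairPerm y 1 ∈ N := left hy
  have := hN _ (Subgroup.inv_mem _ (a_mem a b)) _ hy'
  rw [inv_inv, h.conj_a_inv_pairPerm] at this
  simpa [pairPerm_mul, pairHom_apply] using N.mul_mem hx' this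

theorem exists_iteratedCommutator_le (h : IsBasilica a b) (hle : N ≤ Subgroup.closure {a, b})
    (hN : ∀ g ∈ Subgroup.closure {a, b}, ∀ x ∈ N, g * x * g⁻¹ ∈ N) (hbot : N ≠ ⊥) :
    ∃ n, iteratedCommutator (Subgroup.closure {a, b}) n ≤ N := by
  refine h.normal_induction (P := fun N => ∃ n, iteratedCommutator (Subgroup.closure {a, b}) n ≤ N)
    (fun N _ hN h1 => ⟨_, h.iteratedCommutator_le_of_le_firstSections hN h1⟩)
    (fun N _ hN => ?_) hle hN hbot
  rintro ⟨n, hn⟩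
  exact ⟨_, h.iteratedCommutator_le_of_le_firstSections hN
    ((iteratedCommutator_antitone _ n.le_succ).trans hn)⟩

theorem not_isSolvable (h : IsBasilica a b) : ¬ Group.IsSolvable (Subgroup.closure {a, b}) := by
  rintro ⟨n, hn⟩
  refine h.iteratedCommutator_ne_bot n ?_
  rw [← map_subtype_derivedSeries, hn, Subgroup.map_bot]

theorem isSolvable_quotient (h : IsBasilica a b) (N : Subgroup (Subgroup.closure {a, b}))
    [N.Normal] (hN : N ≠ ⊥) : Group.IsSolvable (Subgroup.closure {a, b} ⧸ N) := by
  obtain ⟨n, hn⟩ := h.exists_iteratedCommutator_le (N := N.map (Subgroup.subtype _))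
    (Subgroup.map_subtype_le N)
    (by
      rintro g hg _ ⟨x, hx, rfl⟩
      exact ⟨⟨g, hg⟩ * x * ⟨g, hg⟩⁻¹, ‹N.Normal›.conj_mem x hx _, rfl⟩)
    (by rwa [Ne, Subgroup.map_eq_bot_iff_of_injective _ (Subgroup.subtype_injective _)])
  rw [← map_subtype_derivedSeries,
    Subgroup.map_le_map_iff_of_injective (Subgroup.subtype_injective _)] at hn
  refine ⟨n, ?_⟩
  rw [← map_derivedSeries_eq (QuotientGroup.mk'_surjective N), Subgroup.map_eq_bot_iff,
    QuotientGroup.ker_mk']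
  exact hn

end IsBasilica

theorem IsFreeGroup.isCyclic_of_comm {A : Type*} [Group A] [IsFreeGroup A]
    (comm : ∀ x y : A, x * y = y * x) : IsCyclic A := by
  have hsub : Subsingleton (IsFreeGroup.Generators A) := by
    refine ⟨fun i j => ?_⟩
    by_contra hij
    classical
    have h := congrArg
      (IsFreeGroup.lift fun k => if k = i then Equiv.swap (0 : Fin 3) 1 else Equiv.swap 1 2)
      (comm (IsFreeGroup.of i) (IsFreeGroup.of j))
    rw [map_mul, map_mul, IsFreeGroup.lift_of, IsFreeGroup.lift_of, if_pos rfl,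
      if_neg (Ne.symm hij)] at h
    revert h
    decide
  have hcyc : IsCyclic (FreeGroup (IsFreeGroup.Generators A)) := by
    cases isEmpty_or_nonempty (IsFreeGroup.Generators A)
    · infer_instance
    · have := uniqueOfSubsingleton (Classical.arbitrary (IsFreeGroup.Generators A))
      infer_instance
  exact isCyclic_of_surjective (IsFreeGroup.mulEquiv A) (IsFreeGroup.mulEquiv A).surjective

namespace FreeGroup

theorem exists_zpow_eq_zpow_of_commute {α : Type*} {u v : FreeGroup α} (hu : u ≠ 1) (hv : v ≠ 1)
    (huv : Commute u v) : ∃ m n : ℤ, m ≠ 0 ∧ n ≠ 0 ∧ u ^ m = v ^ n := by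
  let A := Subgroup.closure {u, v}
  have comm : ∀ x y : A, x * y = y * x := by
    have hcomm : ∀ x ∈ ({u, v} : Set (FreeGroup α)), ∀ y ∈ ({u, v} : Set (FreeGroup α)),
        x * y = y * x := by
      rintro x (rfl | rfl) y (rfl | rfl)
      exacts [rfl, huv, huv.symm, rfl]
    exact (Subgroup.isMulCommutative_closure hcomm).is_comm.comm
  have hA : IsCyclic A := IsFreeGroup.isCyclic_of_comm comm
  obtain ⟨z, hz⟩ := hA.exists_generator
  obtain ⟨m, hm⟩ := hz ⟨u, Subgroup.subset_closure (by simp)⟩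
  obtain ⟨n, hn⟩ := hz ⟨v, Subgroup.subset_closure (by simp)⟩
  have hm' : (z : FreeGroup α) ^ m = u := congrArg Subtype.val hm
  have hn' : (z : FreeGroup α) ^ n = v := congrArg Subtype.val hn
  refine ⟨n, m, ?_, ?_, ?_⟩
  · rintro rfl
    exact hv (by simpa using hn'.symm)
  · rintro rfl
    exact hu (by simpa using hm'.symm)
  · rw [← hm', ← hn', ← zpow_mul, ← zpow_mul, mul_comm]

/-- The positive word in the generators of the free group of rank two encoded by a list. -/
def positiveWord (p : List Bool) : FreeGroup (Fin 2) :=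
  (p.map fun c => FreeGroup.of (bif c then 1 else 0)).prod

theorem positiveWord_injective : Function.Injective positiveWord := by
  let f : Bool → Fin 2 × Bool := fun c => (bif c then 1 else 0, true)
  have hf : Function.Injective f := by decide
  have hmk : ∀ p, positiveWord p = FreeGroup.mk (p.map f) := by
    intro p
    induction p with
    | nil => rfl
    | cons c p ih =>
      have : positiveWord (c :: p) = FreeGroup.of (bif c then 1 else 0) * positiveWord p := by
        simp [positiveWord]
      rw [this, ih]
      rfl
  have hred : ∀ p : List Bool, FreeGroup.IsReduced (p.map f) := by
    intro p
    rw [FreeGroup.IsReduced, List.isChain_map]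
    exact (List.pairwise_of_forall fun _ _ _ => rfl).isChain
  intro p p' h
  rw [hmk, hmk] at h
  have := congrArg FreeGroup.toWord h
  rw [FreeGroup.toWord_mk, FreeGroup.toWord_mk, (hred p).reduce_eq, (hred p').reduce_eq] at this
  exact hf.list_map this

end FreeGroup

/-- Prepend a finite word to an infinite sequence. -/
def prependWord (v : List Bool) (w : ℕ → Bool) : ℕ → Bool :=
  v.foldr cns w

@[simp] theorem prependWord_nil (w : ℕ → Bool) : prependWord [] w = w := rfl

@[simp] theorem prependWord_cons (c : Bool) (v : List Bool) (w : ℕ → Bool) :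
    prependWord (c :: v) w = cns c (prependWord v w) := rfl

theorem exists_eq_prependWord (n : ℕ) (w : ℕ → Bool) :
    ∃ (v : List Bool) (w' : ℕ → Bool), v.length = n ∧ w = prependWord v w' := by
  induction n generalizing w with
  | zero => exact ⟨[], w, rfl, rfl⟩
  | succ n ih =>
    obtain ⟨v, w', hv, hw⟩ := ih fun k => w (k + 1)
    exact ⟨w 0 :: v, w', by simp [hv], by rw [prependWord_cons, ← hw, cns_zero_tail]⟩

namespace IsBasilica

variable {a b : Equiv.Perm (ℕ → Bool)}

/-- The letters `1, a, a⁻¹, b, b⁻¹`. -/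
def letter (a b : Equiv.Perm (ℕ → Bool)) : Option (Bool × Bool) → Equiv.Perm (ℕ → Bool)
  | none => 1
  | some (false, false) => a
  | some (false, true) => a⁻¹
  | some (true, false) => b
  | some (true, true) => b⁻¹

/-- The product of a word in the letters `1, a, a⁻¹, b, b⁻¹`. -/
def evalWord (a b : Equiv.Perm (ℕ → Bool)) (l : List (Option (Bool × Bool))) :
    Equiv.Perm (ℕ → Bool) :=
  (l.map (letter a b)).prod

@[simp] theorem evalWord_nil : evalWord a b [] = 1 := rfl

@[simp] theorem evalWord_cons (s : Option (Bool × Bool)) (l : List (Option (Bool × Bool))) :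
    evalWord a b (s :: l) = letter a b s * evalWord a b l := by
  simp [evalWord]

theorem evalWord_append (l l' : List (Option (Bool × Bool))) :
    evalWord a b (l ++ l') = evalWord a b l * evalWord a b l' := by
  simp [evalWord]

theorem evalWord_replicate_none (n : ℕ) : evalWord a b (List.replicate n none) = 1 := by
  simp [evalWord, letter]

theorem exists_evalWord_inv (l : List (Option (Bool × Bool))) :
    ∃ l', evalWord a b l' = (evalWord a b l)⁻¹ := by
  induction l with
  | nil => exact ⟨[], by simp⟩
  | cons s l ih =>
    obtain ⟨l', hl'⟩ := ih
    refine ⟨l' ++ [s.map fun p => (p.1, !p.2)], ?_⟩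
    have : letter a b (s.map fun p => (p.1, !p.2)) = (letter a b s)⁻¹ := by
      rcases s with _ | ⟨_ | _, _ | _⟩ <;> simp [letter]
    rw [evalWord_append, hl', evalWord_cons, evalWord_cons, evalWord_nil, mul_one, this,
      mul_inv_rev]

theorem exists_evalWord_eq {g : Equiv.Perm (ℕ → Bool)} (hg : g ∈ Subgroup.closure {a, b}) :
    ∃ l, evalWord a b l = g := by
  induction hg using Subgroup.closure_induction with
  | mem g hg =>
    obtain rfl | rfl := hg
    · exact ⟨[some (false, false)], by simp [letter]⟩
    · exact ⟨[some (true, false)], by simp [letter]⟩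
  | one => exact ⟨[], rfl⟩
  | mul g k _ _ ihg ihk =>
    obtain ⟨l, rfl⟩ := ihg
    obtain ⟨l', rfl⟩ := ihk
    exact ⟨l ++ l', evalWord_append _ _⟩
  | inv g _ ihg =>
    obtain ⟨l, rfl⟩ := ihg
    exact exists_evalWord_inv l

/-- The action of a letter on the second level of the tree, with the section there. -/
def secondLevelStep : Option (Bool × Bool) → Bool × Bool → (Bool × Bool) × Option (Bool × Bool)
  | none, v => (v, none)
  | some (false, false), (false, false) => ((true, false), some (false, false))
  | some (false, false), (c, d) => ((!c, d), none)
  | some (false, true), (true, false) => ((false, false), some (false, true))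
  | some (false, true), (c, d) => ((!c, d), none)
  | some (true, false), (false, false) => ((false, true), some (true, false))
  | some (true, false), (false, true) => ((false, false), none)
  | some (true, true), (false, true) => ((false, false), some (true, true))
  | some (true, true), (false, false) => ((false, true), none)
  | some (true, _), (true, d) => ((true, d), none)

theorem letter_cns_cns (h : IsBasilica a b) (s : Option (Bool × Bool)) (v : Bool × Bool)
    (w : ℕ → Bool) :
    letter a b s (cns v.1 (cns v.2 w)) =
      cns (secondLevelStep s v).1.1
        (cns (secondLevelStep s v).1.2 (letter a b (secondLevelStep s v).2 w)) := by
  rcases s with _ | ⟨_ | _, _ | _⟩ <;> rcases v with ⟨_ | _, _ | _⟩ <;>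
    simp [letter, secondLevelStep, h.a_false, h.a_true, h.b_false, h.b_true, h.a_inv_false,
      h.a_inv_true, h.b_inv_false, h.b_inv_true]

/-- Among three successive sections along a path in the second level, one is trivial or
two neighbours cancel. -/
theorem secondLevelStep_three : ∀ (s₁ s₂ s₃ : Option (Bool × Bool)) (v : Bool × Bool),
    let r₃ := secondLevelStep s₃ v
    let r₂ := secondLevelStep s₂ r₃.1
    let r₁ := secondLevelStep s₁ r₂.1
    r₁.2 = none ∨ r₂.2 = none ∨ r₃.2 = none ∨
      r₁.2 = r₂.2.map (fun p => (p.1, !p.2)) ∨ r₂.2 = r₃.2.map (fun p => (p.1, !p.2)) := by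
  decide

theorem exists_pair_eq_three {t₁ t₂ t₃ : Option (Bool × Bool)}
    (ht : t₁ = none ∨ t₂ = none ∨ t₃ = none ∨
      t₁ = t₂.map (fun p => (p.1, !p.2)) ∨ t₂ = t₃.map (fun p => (p.1, !p.2))) :
    ∃ u₁ u₂, letter a b u₁ * letter a b u₂ = letter a b t₁ * letter a b t₂ * letter a b t₃ := by
  have hone : letter a b none = 1 := rfl
  rcases ht with rfl | rfl | rfl | rfl | rfl
  · exact ⟨t₂, t₃, by simp [hone]⟩
  · exact ⟨t₁, t₃, by simp [hone]⟩
  · exact ⟨t₁, t₂, by simp [hone]⟩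
  · refine ⟨none, t₃, ?_⟩
    rcases t₂ with _ | ⟨_ | _, _ | _⟩ <;> simp [letter]
  · refine ⟨t₁, none, ?_⟩
    rcases t₃ with _ | ⟨_ | _, _ | _⟩ <;> simp [letter]

/-- Sections at the second level contract word length by the factor `2/3`. -/
theorem exists_section_cns_cns (h : IsBasilica a b) (q : ℕ) :
    ∀ (l : List (Option (Bool × Bool))), l.length = 3 * q → ∀ c d, ∃ c' d' l',
      l'.length = 2 * q ∧
      ∀ w, evalWord a b l (cns c (cns d w)) = cns c' (cns d' (evalWord a b l' w)) := by
  induction q with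
  | zero =>
    intro l hl c d
    obtain rfl := List.length_eq_zero_iff.1 hl
    exact ⟨c, d, [], rfl, fun _ => rfl⟩
  | succ q ih =>
    intro l hl c d
    obtain ⟨s₁, s₂, s₃, l, rfl⟩ : ∃ s₁ s₂ s₃ l', l = s₁ :: s₂ :: s₃ :: l' := by
      match l, hl with
      | s₁ :: s₂ :: s₃ :: l', _ => exact ⟨_, _, _, _, rfl⟩
      | [], hl => simp at hl
      | [_], hl => simp at hl; omega
      | [_, _], hl => simp at hl; omega
    obtain ⟨c', d', l', hl', hw⟩ := ih l (by simp at hl; omega) c d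
    obtain ⟨u₁, u₂, hu⟩ :=
      exists_pair_eq_three (a := a) (b := b) (secondLevelStep_three s₁ s₂ s₃ (c', d'))
    refine ⟨(secondLevelStep s₁ (secondLevelStep s₂ (secondLevelStep s₃ (c', d')).1).1).1.1,
      (secondLevelStep s₁ (secondLevelStep s₂ (secondLevelStep s₃ (c', d')).1).1).1.2,
      u₁ :: u₂ :: l', by simp; omega, fun w => ?_⟩
    rw [evalWord_cons, evalWord_cons, evalWord_cons, Equiv.Perm.mul_apply, Equiv.Perm.mul_apply,
      Equiv.Perm.mul_apply, hw, h.letter_cns_cns s₃ (c', d'), h.letter_cns_cns s₂,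
      h.letter_cns_cns s₁, evalWord_cons, evalWord_cons, ← mul_assoc, hu]
    rfl

theorem exists_section_prependWord (h : IsBasilica a b) (j : ℕ) :
    ∀ (q : ℕ) (l : List (Option (Bool × Bool))), l.length = 3 ^ j * q →
      ∀ v : List Bool, v.length = 2 * j → ∃ (v' : List Bool) (l' : List (Option (Bool × Bool))),
        v'.length = 2 * j ∧ l'.length = 2 ^ j * q ∧
        ∀ w, evalWord a b l (prependWord v w) = prependWord v' (evalWord a b l' w) := by
  induction j with
  | zero =>
    intro q l hl v hv
    obtain rfl := List.length_eq_zero_iff.1 hv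
    exact ⟨[], l, rfl, by simpa using hl, fun _ => rfl⟩
  | succ j ih =>
    intro q l hl v hv
    obtain ⟨c, d, v, rfl⟩ : ∃ c d v', v = c :: d :: v' := by
      match v, hv with
      | c :: d :: v', _ => exact ⟨_, _, _, rfl⟩
      | [], hv => simp at hv
      | [_], hv => simp at hv; omega
    obtain ⟨c', d', l₁, hl₁, hw₁⟩ :=
      h.exists_section_cns_cns (3 ^ j * q) l (by rw [hl]; ring) c d
    obtain ⟨v', l', hv', hl', hw⟩ :=
      ih (2 * q) l₁ (by rw [hl₁]; ring) v (by simp at hv; omega)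
    exact ⟨c' :: d' :: v', l', by simp; omega, by rw [hl']; ring, fun w => by simp [hw₁, hw]⟩

/-- The `2 ^ n`-th power of an element of `G` fixes the `n`-th level of the tree. -/
theorem exists_pow_prependWord (h : IsBasilica a b) (n : ℕ) {g : Equiv.Perm (ℕ → Bool)}
    (hg : g ∈ Subgroup.closure {a, b}) (v : List Bool) (hv : v.length = n) (w : ℕ → Bool) :
    ∃ w', (g ^ 2 ^ n) (prependWord v w) = prependWord v w' := by
  induction n generalizing g v with
  | zero => obtain rfl := List.length_eq_zero_iff.1 hv; exact ⟨_, rfl⟩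
  | succ n ih =>
    obtain ⟨c, v, rfl⟩ := List.exists_cons_of_length_eq_add_one hv
    obtain ⟨d, hd⟩ := h.exists_hasSectionsIn hg
    have := hd.mul hd
    rw [Bool.xor_self] at this
    obtain ⟨x, hx, y, hy, e⟩ := this.exists_eq_pairPerm
    have hpow : g ^ 2 ^ (n + 1) = pairPerm (x ^ 2 ^ n) (y ^ 2 ^ n) := by
      rw [pow_succ', pow_mul, sq, ← e]
      exact (map_pow pairHom (x, y) (2 ^ n)).symm
    rw [hpow, prependWord_cons]
    cases c
    · obtain ⟨w', hw'⟩ := ih hx v (by simpa using hv)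
      exact ⟨w', by simp [hw']⟩
    · obtain ⟨w', hw'⟩ := ih hy v (by simpa using hv)
      exact ⟨w', by simp [hw']⟩

theorem exists_lt_pow (q : ℕ) : ∃ j : ℕ, 2 ^ (2 * j) * 5 ^ (2 ^ j * q) < 2 ^ 3 ^ j := by
  obtain ⟨j, hj⟩ := pow_unbounded_of_one_lt (3 * q + 2 : ℝ) (by norm_num : (1 : ℝ) < 3 / 2)
  refine ⟨j, ?_⟩
  have hj' : (3 * q + 2) * 2 ^ j < 3 ^ j := by
    rw [div_pow, lt_div_iff₀ (by positivity)] at hj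
    exact_mod_cast hj
  have hlt : j < 2 ^ j := Nat.lt_two_pow_self
  calc 2 ^ (2 * j) * 5 ^ (2 ^ j * q) ≤ 2 ^ (2 * j) * 8 ^ (2 ^ j * q) := by gcongr; norm_num
    _ = 2 ^ (2 * j + 3 * (2 ^ j * q)) := by
      rw [pow_add, pow_mul 2 3]; norm_num
    _ < 2 ^ 3 ^ j := Nat.pow_lt_pow_right (by norm_num) (by nlinarith)

variable {φ : FreeGroup (Fin 2) →* Equiv.Perm (ℕ → Bool)}

theorem exists_evalWord_positiveWord (hφ : ∀ f, φ f ∈ Subgroup.closure {a, b}) :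
    ∃ q, ∀ p : List Bool, ∃ l, l.length = p.length * q ∧
      evalWord a b l = φ (FreeGroup.positiveWord p) := by
  obtain ⟨l₀, h₀⟩ := exists_evalWord_eq (hφ (FreeGroup.of 0))
  obtain ⟨l₁, h₁⟩ := exists_evalWord_eq (hφ (FreeGroup.of 1))
  refine ⟨l₀.length + l₁.length, fun p => ?_⟩
  induction p with
  | nil => exact ⟨[], by simp, by simp [FreeGroup.positiveWord]⟩
  | cons c p ih =>
    obtain ⟨l, hl, e⟩ := ih
    have hcons : FreeGroup.positiveWord (c :: p) =
        FreeGroup.of (bif c then 1 else 0) * FreeGroup.positiveWord p := by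
      simp [FreeGroup.positiveWord]
    cases c
    · refine ⟨l₀ ++ List.replicate l₁.length none ++ l, by simp [hl]; ring, ?_⟩
      rw [evalWord_append, evalWord_append, evalWord_replicate_none, h₀, e, hcons]
      simp
    · refine ⟨l₁ ++ List.replicate l₀.length none ++ l, by simp [hl]; ring, ?_⟩
      rw [evalWord_append, evalWord_append, evalWord_replicate_none, h₁, e, hcons]
      simp

/-- At some level of the tree, every cylinder is fixed pointwise by a non-trivial element of a
given free subgroup: there are more positive words than possible sections. -/
theorem exists_forall_cylinder_fixed (h : IsBasilica a b)
    (hφ : ∀ f, φ f ∈ Subgroup.closure {a, b}) :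
    ∃ k, ∀ v : List Bool, v.length = k →
      ∃ f ≠ 1, ∀ w, φ f (prependWord v w) = prependWord v w := by
  obtain ⟨q, hq⟩ := exists_evalWord_positiveWord hφ
  obtain ⟨j, hj⟩ := exists_lt_pow q
  refine ⟨2 * j, fun v hv => ?_⟩
  have hsec : ∀ p : List.Vector Bool (3 ^ j), ∃ r : List.Vector Bool (2 * j) ×
      List.Vector (Option (Bool × Bool)) (2 ^ j * q), ∀ w,
      φ (FreeGroup.positiveWord p.1) (prependWord v w) =
        prependWord r.1.1 (evalWord a b r.2.1 w) := by
    intro p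
    obtain ⟨l, hl, e⟩ := hq p.1
    rw [p.2] at hl
    obtain ⟨v', l', hv', hl', hw⟩ := h.exists_section_prependWord j q l hl v hv
    exact ⟨⟨⟨v', hv'⟩, ⟨l', hl'⟩⟩, fun w => by rw [← e, hw]⟩
  choose r hr using hsec
  obtain ⟨p, p', hne, heq⟩ := Fintype.exists_ne_map_eq_of_card_lt r (by
    simpa [Fintype.card_prod, card_vector] using hj)
  refine ⟨(FreeGroup.positiveWord p.1)⁻¹ * FreeGroup.positiveWord p'.1, ?_, fun w => ?_⟩
  · rw [Ne, inv_mul_eq_one]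
    exact fun e => hne (Subtype.ext (FreeGroup.positiveWord_injective e))
  · rw [map_mul, map_inv, Equiv.Perm.mul_apply, Equiv.Perm.inv_eq_iff_eq, hr, hr, heq]

theorem commutatorElement_apply_eq_self {X : Type*} {f g : Equiv.Perm X} {x : X}
    (hx : f x = x) (hgx : f (g⁻¹ x) = g⁻¹ x) : ⁅f, g⁆ x = x := by
  have hgx' : f⁻¹ (g⁻¹ x) = g⁻¹ x := Equiv.Perm.inv_eq_iff_eq.2 hgx.symm
  rw [commutatorElement_def, Equiv.Perm.mul_apply, Equiv.Perm.mul_apply, Equiv.Perm.mul_apply,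
    hgx', show g (g⁻¹ x) = x from g.apply_symm_apply x, hx]

theorem not_injective_of_forall_mem (h : IsBasilica a b)
    (hφ : ∀ f, φ f ∈ Subgroup.closure {a, b}) : ¬ Function.Injective φ := by
  intro hinj
  obtain ⟨k, hk⟩ := h.exists_forall_cylinder_fixed hφ
  have hinv : ∀ (f : FreeGroup (Fin 2)) (v : List.Vector Bool k) (w : ℕ → Bool),
      ∃ w', (φ (f ^ 2 ^ k))⁻¹ (prependWord v.1 w) = prependWord v.1 w' := by
    intro f v w
    rw [map_pow, ← inv_pow, ← map_inv]
    exact h.exists_pow_prependWord k (hφ _) v.1 v.2 w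
  have hpow : ∀ (f : FreeGroup (Fin 2)) (x : ℕ → Bool), φ f x = x → φ (f ^ 2 ^ k) x = x := by
    intro f x hx
    rw [map_pow]
    exact Equiv.Perm.pow_apply_eq_self_of_apply_eq_self hx _
  have hne : ∀ f : FreeGroup (Fin 2), f ≠ 1 → f ^ 2 ^ k ≠ 1 :=
    fun f hf e => hf ((pow_eq_one_iff_left (by positivity)).1 e)
  have key : ∀ V : Finset (List.Vector Bool k), ∃ f ≠ 1,
      ∀ v ∈ V, ∀ w, φ f (prependWord v.1 w) = prependWord v.1 w := by
    intro V
    induction V using Finset.induction_on with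
    | empty => exact ⟨FreeGroup.of 0, FreeGroup.of_ne_one _, by simp⟩
    | insert v V _ ih =>
      obtain ⟨f, hf, hfV⟩ := ih
      obtain ⟨g, hg, hgv⟩ := hk v.1 v.2
      by_cases hc : Commute (f ^ 2 ^ k) (g ^ 2 ^ k)
      · obtain ⟨m, n, hm, -, hmn⟩ :=
          FreeGroup.exists_zpow_eq_zpow_of_commute (hne f hf) (hne g hg) hc
        refine ⟨(f ^ 2 ^ k) ^ m,
          fun e => hne f hf ((IsMulTorsionFree.zpow_eq_one_iff_left hm).1 e), ?_⟩
        intro u hu w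
        obtain rfl | hu := Finset.mem_insert.1 hu
        · rw [hmn, map_zpow]
          exact Equiv.Perm.zpow_apply_eq_self_of_apply_eq_self (hpow _ _ (hgv w)) _
        · rw [map_zpow]
          exact Equiv.Perm.zpow_apply_eq_self_of_apply_eq_self (hpow _ _ (hfV u hu w)) _
      · refine ⟨⁅f ^ 2 ^ k, g ^ 2 ^ k⁆, by rwa [Ne, commutatorElement_eq_one_iff_commute], ?_⟩
        intro u hu w
        obtain rfl | hu := Finset.mem_insert.1 hu
        · obtain ⟨w', hw'⟩ := hinv f u w
          rw [← commutatorElement_inv, map_inv, map_commutatorElement, Equiv.Perm.inv_eq_iff_eq]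
          refine (commutatorElement_apply_eq_self (hpow _ _ (hgv w)) ?_).symm
          rw [hw']
          exact hpow _ _ (hgv w')
        · obtain ⟨w', hw'⟩ := hinv g u w
          rw [map_commutatorElement]
          refine commutatorElement_apply_eq_self (hpow _ _ (hfV u hu w)) ?_
          rw [hw']
          exact hpow _ _ (hfV u hu w')
  obtain ⟨f, hf, hV⟩ := key Finset.univ
  refine hf (hinj ?_)
  rw [map_one]
  refine Equiv.ext fun w => ?_
  obtain ⟨v, w', hv, rfl⟩ := exists_eq_prependWord k w
  exact hV ⟨v, hv⟩ (Finset.mem_univ _) w'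

end IsBasilica

/-- The group `G = IMG(z²−1)` is just non-solvable: `G` is not solvable, but `G/N` is
solvable for every non-trivial normal subgroup `N`. Moreover `G` contains no free
non-abelian subgroup of rank 2. -/
theorem img_z2_minus_1_just_nonsolvable
    (a b : Equiv.Perm (ℕ → Bool))
    (ha0 : ∀ w, a (cns false w) = cns true (b w))
    (ha1 : ∀ w, a (cns true w) = cns false w)
    (hb0 : ∀ w, b (cns false w) = cns false (a w))
    (hb1 : ∀ w, b (cns true w) = cns true w) :
    ¬ IsSolvable ↥(Subgroup.closure ({a, b} : Set (Equiv.Perm (ℕ → Bool)))) ∧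
    (∀ (N : Subgroup ↥(Subgroup.closure ({a, b} : Set (Equiv.Perm (ℕ → Bool)))))
      [N.Normal], N ≠ ⊥ →
      IsSolvable (↥(Subgroup.closure ({a, b} : Set (Equiv.Perm (ℕ → Bool)))) ⧸ N)) ∧
    (∀ K : Subgroup ↥(Subgroup.closure ({a, b} : Set (Equiv.Perm (ℕ → Bool)))),
      ¬Nonempty (↥K ≃* FreeGroup (Fin 2))) := by
  have h : IsBasilica a b := ⟨ha0, ha1, hb0, hb1⟩
  refine ⟨h.not_isSolvable, fun N _ hN => h.isSolvable_quotient N hN, ?_⟩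
  rintro K ⟨e⟩
  exact h.not_injective_of_forall_mem
    (φ := ((Subgroup.subtype _).comp K.subtype).comp e.symm.toMonoidHom)
    (fun f => (e.symm f).1.2)
    ((Subtype.val_injective.comp Subtype.val_injective).comp e.symm.injective)
end
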